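/- Let (M, d_M) be a metric space of diameter at most 2, with the pseudometric d((t,x),(s,y)) = |t − s| + min{t,s}·d_M(x,y) on ℝ≥0 × M. Let Z = {((t,x), s) ∈ (ℝ≥0 × M) × ℝ : 0 ≤ s ≤ t/2}, equipped with the pseudometric d_Z(((t,x),s), ((t',x'),s')) = d((t,x),(t',x')) + |s − s'|. Then the map h : Z → ℝ≥0 × M defined by h((t,x), s) = (t − s, x) is 1-Lipschitz, i.e. d(h(z), h(z')) ≤ d_Z(z, z') for all z, z' ∈ Z, and is proper (the preimage of every d-bounded set is d_Z-bounded); moreover h((t,x), 0) = (t,x) and h((t,x), t/2) = (t/2, x) = f(t,x), where f(t,x) = (t/2, x). -/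

import Mathlib

/-- Let `M` be a metric space of diameter at most 2, with the cone
pseudometric `d((t,x),(s,y)) = |t − s| + min t s * d_M(x,y)` on pairs (first coordinate a
nonnegative real).  Let `Z = {((t,x),s) : 0 ≤ t, 0 ≤ s ≤ t/2}` carry the sum pseudometric
`d_Z(((t,x),s),((t',x'),s')) = d((t,x),(t',x')) + |s − s'|`.  Then the map
`h((t,x),s) = (t − s, x)` is 1-Lipschitz on `Z`, is proper (the preimage of every
`d`-bounded set is `d_Z`-bounded), and satisfies `h((t,x),0) = (t,x)` and
`h((t,x),t/2) = (t/2,x) = f(t,x)`. -/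
theorem stmt_3 {M : Type*} [MetricSpace M]
    (hM : ∀ x y : M, dist x y ≤ 2)
    (d : (ℝ × M) → (ℝ × M) → ℝ)
    (hd : ∀ p q : ℝ × M, d p q = |p.1 - q.1| + min p.1 q.1 * dist p.2 q.2)
    (dZ : ((ℝ × M) × ℝ) → ((ℝ × M) × ℝ) → ℝ)
    (hdZ : ∀ z z' : (ℝ × M) × ℝ, dZ z z' = d z.1 z'.1 + |z.2 - z'.2|)
    (Z : Set ((ℝ × M) × ℝ))
    (hZ : Z = {z : (ℝ × M) × ℝ | 0 ≤ z.1.1 ∧ 0 ≤ z.2 ∧ z.2 ≤ z.1.1 / 2})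
    (h : (ℝ × M) × ℝ → ℝ × M)
    (hh : ∀ z : (ℝ × M) × ℝ, h z = (z.1.1 - z.2, z.1.2)) :
    (∀ z ∈ Z, ∀ z' ∈ Z, d (h z) (h z') ≤ dZ z z') ∧
    (∀ B : Set (ℝ × M), (∃ C : ℝ, ∀ p ∈ B, ∀ q ∈ B, d p q ≤ C) →
      ∃ C : ℝ, ∀ z ∈ Z, ∀ z' ∈ Z, h z ∈ B → h z' ∈ B → dZ z z' ≤ C) ∧
    (∀ (t : ℝ) (x : M), h ((t, x), 0) = (t, x)) ∧
    (∀ (t : ℝ) (x : M), h ((t, x), t / 2) = (t / 2, x)) := by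
  subst hZ
  refine ⟨?_, ?_, fun t x => by simp [hh], fun t x => ?_⟩
  · rintro ⟨⟨t, x⟩, s⟩ ⟨-, hs, -⟩ ⟨⟨t', x'⟩, s'⟩ ⟨-, hs', -⟩
    simp only [hdZ, hd, hh] at *
    have habs : |t - s - (t' - s')| ≤ |t - t'| + |s - s'| := by
      rw [sub_sub_sub_comm]
      exact abs_sub _ _
    have hmin : min (t - s) (t' - s') * dist x x' ≤ min t t' * dist x x' := by
      gcongr <;> linarith
    linarith
  · rintro B ⟨C, hC⟩
    by_cases hne : ∃ z₀ : (ℝ × M) × ℝ, (0 ≤ z₀.1.1 ∧ 0 ≤ z₀.2 ∧ z₀.2 ≤ z₀.1.1 / 2) ∧ h z₀ ∈ B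
    · obtain ⟨z₀, ⟨ht₀, hs₀, hst₀⟩, hz₀⟩ := hne
      have radius_le : ∀ z : (ℝ × M) × ℝ, 0 ≤ z.1.1 → z.2 ≤ z.1.1 / 2 → h z ∈ B →
          z.1.1 ≤ 2 * (z₀.1.1 - z₀.2 + C) := by
        intro z ht hst hz
        have hdist := hC _ hz _ hz₀
        simp only [hd, hh] at hdist
        have hnonneg : 0 ≤ min (z.1.1 - z.2) (z₀.1.1 - z₀.2) * dist z.1.2 z₀.1.2 :=
          mul_nonneg (le_min (by linarith) (by linarith)) dist_nonneg
        linarith [le_abs_self (z.1.1 - z.2 - (z₀.1.1 - z₀.2))]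
      refine ⟨4 * (2 * (z₀.1.1 - z₀.2 + C)), ?_⟩
      rintro z ⟨ht, hs, hst⟩ z' ⟨ht', hs', hst'⟩ hz hz'
      have hr := radius_le z ht hst hz
      have hr' := radius_le z' ht' hst' hz'
      rw [hdZ, hd]
      have hmin : min z.1.1 z'.1.1 * dist z.1.2 z'.1.2 ≤ z.1.1 * 2 :=
        mul_le_mul (min_le_left _ _) (hM _ _) dist_nonneg ht
      have habs_t : |z.1.1 - z'.1.1| ≤ 2 * (z₀.1.1 - z₀.2 + C) :=
        abs_le.2 ⟨by linarith, by linarith⟩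
      have habs_s : |z.2 - z'.2| ≤ 2 * (z₀.1.1 - z₀.2 + C) :=
        abs_le.2 ⟨by linarith, by linarith⟩
      linarith
    · exact ⟨0, fun z hz _ _ hzB _ => (hne ⟨z, hz, hzB⟩).elim⟩
  · rw [hh]
    simp only [sub_half]
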